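/- arXiv:2204.13195 — 2 statements merged into one kernel-verified Lean document; each statement's English description precedes it below -/
import Mathlib

section
/- Let γ > 0, θ > 0, and for each worker p in a finite index set of cardinality P let m_p > 0, b_p > 0, a_p ∈ ℝ. Define the active set 𝒫ᵃ = {p : a_p < θ} and let κ_p = κ_p(θ) = (b_p/(2γ m_p²))·(−1 + √(1 + 4γ m_p²(θ − a_p)⁺/b_p²)). Then the objective function F(κ) = ∑_p (a_p·𝟙[κ_p > 0] + b_p·κ_p + γ·m_p²·κ_p² − θ)² evaluated at this assignment equals (P − |𝒫ᵃ|)·θ²: each active worker's summand vanishes and each inactive worker's summand equals θ². -/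
open Finset

/-- The nonnegative root of `c * k ^ 2 + b * k = x`. -/
theorem quadratic_root_eq {c b x : ℝ} (hc : 0 < c) (hb : 0 < b) (hx : 0 ≤ x) :
    b * (b / (2 * c) * (-1 + √(1 + 4 * c * x / b ^ 2))) +
      c * (b / (2 * c) * (-1 + √(1 + 4 * c * x / b ^ 2))) ^ 2 = x := by
  have hs : √(1 + 4 * c * x / b ^ 2) ^ 2 = 1 + 4 * c * x / b ^ 2 :=
    Real.sq_sqrt (by positivity)
  generalize √(1 + 4 * c * x / b ^ 2) = s at hs ⊢
  calc b * (b / (2 * c) * (-1 + s)) + c * (b / (2 * c) * (-1 + s)) ^ 2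
      = b ^ 2 / (4 * c) * (s ^ 2 - 1) := by field_simp; ring
    _ = x := by rw [hs]; field_simp; ring

theorem quadratic_root_pos {c b x : ℝ} (hc : 0 < c) (hb : 0 < b) (hx : 0 < x) :
    0 < b / (2 * c) * (-1 + √(1 + 4 * c * x / b ^ 2)) := by
  have hpos : 0 < 4 * c * x / b ^ 2 := by positivity
  have hs : 1 < √(1 + 4 * c * x / b ^ 2) := Real.lt_sqrt_of_sq_lt (by linarith)
  exact mul_pos (by positivity) (by linarith)

/-- Evaluating the load-split objective
`F(κ) = ∑_p (a_p·𝟙[κ_p > 0] + b_p·κ_p + γ·m_p²·κ_p² − θ)²` at the optimal assignment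
`κ_p = (b_p/(2γ m_p²))·(−1 + √(1 + 4γ m_p²(θ − a_p)⁺/b_p²))` gives
`(P − |𝒫ᵃ|)·θ²`, where `𝒫ᵃ = {p : a_p < θ}` is the active set: each active worker's
summand vanishes and each inactive worker's summand equals `θ²`. -/
theorem objective_at_optimal_split
    {ι : Type*} [Fintype ι] [DecidableEq ι]
    (γ θ : ℝ) (hγ : 0 < γ) (hθ : 0 < θ)
    (m b a : ι → ℝ) (hm : ∀ p, 0 < m p) (hb : ∀ p, 0 < b p)
    (κ : ι → ℝ)
    (hκ : ∀ p, κ p = b p / (2 * γ * (m p) ^ 2) *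
      (-1 + Real.sqrt (1 + 4 * γ * (m p) ^ 2 * max (θ - a p) 0 / (b p) ^ 2))) :
    (∀ p, a p < θ →
      ((a p * (if 0 < κ p then (1 : ℝ) else 0) + b p * κ p
        + γ * (m p) ^ 2 * (κ p) ^ 2 - θ) ^ 2 = 0)) ∧
    (∀ p, ¬ a p < θ →
      ((a p * (if 0 < κ p then (1 : ℝ) else 0) + b p * κ p
        + γ * (m p) ^ 2 * (κ p) ^ 2 - θ) ^ 2 = θ ^ 2)) ∧
    (∑ p : ι, (a p * (if 0 < κ p then (1 : ℝ) else 0) + b p * κ p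
        + γ * (m p) ^ 2 * (κ p) ^ 2 - θ) ^ 2
      = ((Fintype.card ι : ℝ) - ((univ.filter (fun p => a p < θ)).card : ℝ)) * θ ^ 2) := by
  have hc (p : ι) : 0 < γ * m p ^ 2 := mul_pos hγ (pow_pos (hm p) 2)
  have active : ∀ p, a p < θ →
      (a p * (if 0 < κ p then (1 : ℝ) else 0) + b p * κ p
        + γ * (m p) ^ 2 * (κ p) ^ 2 - θ) ^ 2 = 0 := by
    intro p hp
    have hx : 0 < θ - a p := sub_pos.2 hp
    have hroot := quadratic_root_eq (hc p) (hb p) hx.le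
    have hpos := quadratic_root_pos (hc p) (hb p) hx
    have hk := hκ p
    rw [max_eq_left hx.le, mul_assoc 2, mul_assoc 4] at hk
    rw [← hk] at hroot hpos
    rw [if_pos hpos, sq_eq_zero_iff]
    linarith
  have inactive : ∀ p, ¬ a p < θ →
      (a p * (if 0 < κ p then (1 : ℝ) else 0) + b p * κ p
        + γ * (m p) ^ 2 * (κ p) ^ 2 - θ) ^ 2 = θ ^ 2 := by
    intro p hp
    have hk : κ p = 0 := by
      rw [hκ p, max_eq_right (sub_nonpos.2 (not_lt.1 hp))]
      simp
    simp [hk]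
  refine ⟨active, inactive, ?_⟩
  have hcard := card_filter_add_card_filter_not (s := (univ : Finset ι)) (fun p => a p < θ)
  rw [← sum_filter_add_sum_filter_not univ (fun p => a p < θ),
    sum_eq_zero fun p hp => active p (mem_filter.1 hp).2,
    sum_congr rfl fun p hp => inactive p (mem_filter.1 hp).2,
    ← card_univ, ← hcard, sum_const, nsmul_eq_mul]
  push_cast
  ring
end

section
/- Let γ > 0 and let p range over a nonempty finite index set, with m_p > 0, b_p > 0, a_p ≥ 0 for each p. Define κ_p(θ) = (b_p/(2γ m_p²))·(−1 + √(1 + 4γ m_p²(θ − a_p)⁺/b_p²)) with (x)⁺ = max(x, 0), and S(θ) = ∑_p κ_p(θ). Then for every target load L > 0 there exists a unique θ ∈ ℝ with S(θ) = L; moreover this θ satisfies θ > min_p a_p. (S is continuous, vanishes for θ ≤ min_p a_p, is strictly increasing for θ > min_p a_p, and tends to infinity as θ → ∞, so the unique θ can be found by a binary search.) -/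
open Finset

/-- The load assigned at threshold `θ` to a worker with task-time mean `m`, coefficient `b` and
offset `a`. -/
noncomputable def workerLoad (γ m b a θ : ℝ) : ℝ :=
  b / (2 * γ * m ^ 2) * (-1 + Real.sqrt (1 + 4 * γ * m ^ 2 * max (θ - a) 0 / b ^ 2))

namespace workerLoad

variable {γ m b a : ℝ}

theorem continuous : Continuous (workerLoad γ m b a) := by
  unfold workerLoad
  fun_prop

theorem eq_zero_of_le {θ : ℝ} (h : θ ≤ a) : workerLoad γ m b a θ = 0 := by
  simp [workerLoad, max_eq_right (sub_nonpos.mpr h)]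

theorem monotone (hγ : 0 < γ) (hb : 0 < b) : Monotone (workerLoad γ m b a) := by
  intro x y hxy
  unfold workerLoad
  gcongr

theorem nonneg (hγ : 0 < γ) (hb : 0 < b) (θ : ℝ) : 0 ≤ workerLoad γ m b a θ := by
  rw [← eq_zero_of_le (γ := γ) (m := m) (b := b) (min_le_right θ a)]
  exact monotone hγ hb (min_le_left θ a)

theorem strictMonoOn (hγ : 0 < γ) (hm : 0 < m) (hb : 0 < b) :
    StrictMonoOn (workerLoad γ m b a) (Set.Ici a) := by
  intro x hx y hy hxy
  unfold workerLoad
  rw [max_eq_left (sub_nonneg.mpr hx), max_eq_left (sub_nonneg.mpr hy)]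
  have hx' : 0 ≤ x - a := sub_nonneg.mpr hx
  gcongr

theorem tendsto_atTop (hγ : 0 < γ) (hm : 0 < m) (hb : 0 < b) :
    Filter.Tendsto (workerLoad γ m b a) Filter.atTop Filter.atTop := by
  have hmax : Filter.Tendsto (fun θ : ℝ => max (θ - a) 0) Filter.atTop Filter.atTop :=
    Filter.tendsto_atTop_mono (fun θ => le_max_left _ _)
      (Filter.tendsto_atTop_add_const_right _ (-a) Filter.tendsto_id)
  have hmul := hmax.const_mul_atTop (show 0 < 4 * γ * m ^ 2 by positivity)
  have hdiv := hmul.atTop_div_const (show 0 < b ^ 2 by positivity)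
  have hsqrt := Real.tendsto_sqrt_atTop.comp (Filter.tendsto_atTop_add_const_left _ 1 hdiv)
  exact (Filter.tendsto_atTop_add_const_left _ (-1) hsqrt).const_mul_atTop
    (show 0 < b / (2 * γ * m ^ 2) by positivity)

end workerLoad

/-- For a nonempty finite family of workers with `m_p > 0`, `b_p > 0`,
`a_p ≥ 0`, and `γ > 0`, let `S(θ) = ∑_p κ_p(θ)` with
`κ_p(θ) = (b_p/(2γ m_p²))·(−1 + √(1 + 4γ m_p²(θ − a_p)⁺/b_p²))`. Then for every
target load `L > 0` there is a unique `θ` with `S(θ) = L`, and any such `θ`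
satisfies `θ > min_p a_p`. -/
theorem unique_threshold_for_total_load
    {ι : Type*} [Fintype ι] [Nonempty ι]
    (γ : ℝ) (hγ : 0 < γ)
    (m b a : ι → ℝ) (hm : ∀ p, 0 < m p) (hb : ∀ p, 0 < b p) (ha : ∀ p, 0 ≤ a p)
    (κ : ι → ℝ → ℝ)
    (hκ : ∀ p (θ : ℝ), κ p θ = b p / (2 * γ * (m p) ^ 2) *
      (-1 + Real.sqrt (1 + 4 * γ * (m p) ^ 2 * max (θ - a p) 0 / (b p) ^ 2)))
    (L : ℝ) (hL : 0 < L) :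
    (∃! θ : ℝ, ∑ p : ι, κ p θ = L) ∧
    (∀ θ : ℝ, ∑ p : ι, κ p θ = L → univ.inf' univ_nonempty a < θ) := by
  obtain rfl : κ = fun p => workerLoad γ (m p) (b p) (a p) := by
    funext p θ
    exact hκ p θ
  have active : ∀ θ : ℝ, 0 < ∑ p, workerLoad γ (m p) (b p) (a p) θ → ∃ p, a p < θ := by
    intro θ hθ
    by_contra! h
    exact hθ.ne' (sum_eq_zero fun p _ => workerLoad.eq_zero_of_le (h p))
  have lt_of_lt : ∀ x y : ℝ, 0 < ∑ p, workerLoad γ (m p) (b p) (a p) x → x < y →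
      ∑ p, workerLoad γ (m p) (b p) (a p) x < ∑ p, workerLoad γ (m p) (b p) (a p) y := by
    intro x y hx hxy
    obtain ⟨p, hp⟩ := active x hx
    exact sum_lt_sum (fun q _ => workerLoad.monotone hγ (hb q) hxy.le)
      ⟨p, mem_univ p, workerLoad.strictMonoOn hγ (hm p) (hb p) hp.le (hp.trans hxy).le hxy⟩
  refine ⟨existsUnique_of_exists_of_unique ?_ ?_, ?_⟩
  · have hcont : Continuous fun θ => ∑ p, workerLoad γ (m p) (b p) (a p) θ :=
      continuous_finsetSum _ fun p _ => workerLoad.continuous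
    refine mem_range_of_exists_le_of_exists_ge hcont
      ⟨univ.inf' univ_nonempty a, ?_⟩ ?_
    · rw [sum_eq_zero fun p _ => workerLoad.eq_zero_of_le (inf'_le a (mem_univ p))]
      exact hL.le
    · obtain ⟨p⟩ := ‹Nonempty ι›
      obtain ⟨θ, hθ⟩ :=
        ((workerLoad.tendsto_atTop hγ (hm p) (hb p)).eventually_ge_atTop L).exists
      exact ⟨θ, hθ.trans (single_le_sum
        (f := fun q => workerLoad γ (m q) (b q) (a q) θ)
        (fun q _ => workerLoad.nonneg hγ (hb q) θ) (mem_univ p))⟩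
  · intro x y hx hy
    rcases lt_trichotomy x y with h | h | h
    · exact absurd (lt_of_lt x y (hL.trans_eq hx.symm) h) (hx.trans hy.symm).not_lt
    · exact h
    · exact absurd (lt_of_lt y x (hL.trans_eq hy.symm) h) (hy.trans hx.symm).not_lt
  · intro θ hθ
    obtain ⟨p, hp⟩ := active θ (hL.trans_eq hθ.symm)
    exact (inf'_le a (mem_univ p)).trans_lt hp
end
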